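/- Let M be positive semidefinite and the box uncertainty set full-dimensional (ū_i > 0 for all i). If the nominal LCP(q̄, M) has more than one solution, then no AAR solution of the uncertain LCP exists. -/

import Mathlib

open Matrix BigOperators
open scoped Classical

noncomputable section

/-- `u` lies in the box `[-ū, ū]`. -/
def inBox {n : ℕ} (ubar u : Fin n → ℝ) : Prop :=
  ∀ i, -ubar i ≤ u i ∧ u i ≤ ubar i

/-- `z` solves the LCP with matrix `M` and vector `q`. -/
def IsLCPSol {n : ℕ} (M : Matrix (Fin n) (Fin n) ℝ) (q z : Fin n → ℝ) : Prop :=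
  (∀ i, 0 ≤ z i) ∧ (∀ i, 0 ≤ (M.mulVec z + q) i) ∧
    ∑ i, z i * (M.mulVec z + q) i = 0

/-- `z(u) = D u + r` is an affinely adjustable robust solution of the
uncertain LCP with vector `q(u) = q̄ + u`. -/
def IsAAR {n : ℕ} (M : Matrix (Fin n) (Fin n) ℝ) (qbar ubar : Fin n → ℝ)
    (D : Matrix (Fin n) (Fin n) ℝ) (r : Fin n → ℝ) : Prop :=
  ∀ u, inBox ubar u → IsLCPSol M (qbar + u) (D.mulVec u + r)

theorem aar_eq_aux {n : ℕ} (M : Matrix (Fin n) (Fin n) ℝ) (qbar ubar : Fin n → ℝ)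
    (hubar : ∀ i, 0 < ubar i)
    (hpsd : ∀ x : Fin n → ℝ, 0 ≤ ∑ i, x i * (M.mulVec x) i)
    (D : Matrix (Fin n) (Fin n) ℝ) (r : Fin n → ℝ) (hA : IsAAR M qbar ubar D r)
    (z : Fin n → ℝ) (hz : IsLCPSol M qbar z) : r = z := by
  funext i
  by_contra hne
  have key : ∀ s : ℝ, |s| ≤ ubar i → (D i i * s + r i - z i) * s ≤ 0 := by
    intro s hs
    have hb : inBox ubar (Pi.single i s) := by
      intro j
      by_cases hj : j = i
      · subst hj
        simpa using abs_le.mp hs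
      · simpa [hj] using (hubar j).le
    obtain ⟨a1, a2, a3⟩ := hA _ hb
    obtain ⟨b1, b2, b3⟩ := hz
    have hyi : (D.mulVec (Pi.single i s) + r) i = D i i * s + r i := by
      simp [Matrix.mulVec_single, mul_comm]
    generalize D.mulVec (Pi.single i s) + r = y at *
    have hp := hpsd (y - z)
    have c1 : 0 ≤ ∑ j, y j * (M.mulVec z + qbar) j :=
      Finset.sum_nonneg fun j _ => mul_nonneg (a1 j) (b2 j)
    have c2 : 0 ≤ ∑ j, z j * (M.mulVec y + (qbar + (Pi.single i s : Fin n → ℝ))) j :=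
      Finset.sum_nonneg fun j _ => mul_nonneg (b1 j) (a2 j)
    have e : ∑ j, (y - z) j * (M.mulVec (y - z)) j + ∑ j, (y - z) j * (Pi.single i s : Fin n → ℝ) j
        = ∑ j, y j * (M.mulVec y + (qbar + (Pi.single i s : Fin n → ℝ))) j + ∑ j, z j * (M.mulVec z + qbar) j
          - ∑ j, y j * (M.mulVec z + qbar) j
          - ∑ j, z j * (M.mulVec y + (qbar + (Pi.single i s : Fin n → ℝ))) j := by
      rw [← Finset.sum_add_distrib, ← Finset.sum_add_distrib, ← Finset.sum_sub_distrib,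
        ← Finset.sum_sub_distrib]
      refine Finset.sum_congr rfl fun j _ => ?_
      rw [Matrix.mulVec_sub]
      simp only [Pi.add_apply, Pi.sub_apply]
      ring
    have e2 : ∑ j, (y - z) j * (Pi.single i s : Fin n → ℝ) j = (y i - z i) * s := by
      rw [Finset.sum_eq_single i]
      · simp
      · intro j _ hj
        simp [hj]
      · simp
    rw [← hyi]
    linarith
  have hu := hubar i
  set d := r i - z i with hd
  have hd0 : d ≠ 0 := sub_ne_zero.mpr hne
  have hq : 0 ≤ |d| / ubar i := by positivity
  have hK : 0 < |D i i| + 1 + |d| / ubar i := by positivity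
  set K := |D i i| + 1 + |d| / ubar i with hKd
  have h1 : |d / K| ≤ ubar i := by
    rw [abs_div, abs_of_pos hK, div_le_iff₀ hK]
    have : ubar i * (|d| / ubar i) = |d| := by field_simp
    have := mul_nonneg hu.le (abs_nonneg (D i i))
    rw [hKd]
    nlinarith
  have h2 := key _ h1
  have h3 : (D i i * (d / K) + r i - z i) * (d / K) = (D i i + K) * (d / K) ^ 2 := by
    have : r i - z i = K * (d / K) := by field_simp; rfl
    linear_combination (d / K) * this
  have h4 : 0 < (d / K) ^ 2 := by positivity
  have h5 : 0 < D i i + K := by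
    have := neg_abs_le (D i i)
    linarith
  have := mul_pos h5 h4
  linarith

/-- for positive semidefinite `M` and full-dimensional box
uncertainty, if the nominal LCP has more than one solution then no AAR
solution exists. -/
theorem stmt_14 (n h : ℕ) (M : Matrix (Fin n) (Fin n) ℝ) (qbar ubar : Fin n → ℝ)
    (hubar : ∀ i, 0 < ubar i)
    (hpsd : ∀ x : Fin n → ℝ, 0 ≤ ∑ i, x i * (M.mulVec x) i)
    (z1 z2 : Fin n → ℝ) (h1 : IsLCPSol M qbar z1) (h2 : IsLCPSol M qbar z2)
    (hne : z1 ≠ z2) :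
    ¬ ∃ (D : Matrix (Fin n) (Fin n) ℝ) (r : Fin n → ℝ),
        (∀ i : Fin n, (i : ℕ) < h → ∀ j, D i j = 0) ∧
        IsAAR M qbar ubar D r := by
  rintro ⟨D, r, -, hA⟩
  exact hne ((aar_eq_aux M qbar ubar hubar hpsd D r hA z1 h1).symm.trans
    (aar_eq_aux M qbar ubar hubar hpsd D r hA z2 h2))
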